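/- Let L ≅ SL(2,5) and let G = LC be a central product of L with a subgroup C of G, with central amalgamated subgroup Z := Z(L) = L ∩ C, and assume L ⊆ G' (the derived subgroup of G). Assume G has a complex irreducible character χ of degree 2 with Z not contained in Ker(χ). Then: (i) n_2(G) = 2·n_1(G) + n_2(C/Z); (ii) n_3(G) ≥ 2·n_1(G); (iii) n_4(G) ≥ 2·n_1(G); (iv) n_5(G) ≥ n_1(G); (v) n_6(G) ≥ n_1(G); and (vi) n_8(G) ≥ n_2(C/Z). -/

import Mathlib

open Module CategoryTheory

noncomputable section

/-- `χ : G → ℂ` is the character of an irreducible complex representation of `G`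
of degree `d`. -/
def IsIrrCharDeg (G : Type) [Group G] (χ : G → ℂ) (d : ℕ) : Prop :=
  ∃ V : FDRep ℂ G, Simple V ∧ χ = FDRep.character V ∧ finrank ℂ V = d

/-- `χ : G → ℂ` is an irreducible complex character of `G`. -/
def IsIrrChar (G : Type) [Group G] (χ : G → ℂ) : Prop :=
  ∃ d, IsIrrCharDeg G χ d

/-- `n_d(G)`: the number of irreducible complex characters of `G` of degree `d`. -/
def nChars (G : Type) [Group G] (d : ℕ) : ℕ :=
  {χ : G → ℂ | IsIrrCharDeg G χ d}.ncard

def IsCh (H : Type) [Group H] (χ : H → ℂ) (d : ℕ) : Prop :=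
  ∃ M : H →* Matrix (Fin d) (Fin d) ℂ, ∀ g, χ g = Matrix.trace (M g)

def repOf {H : Type} [Group H] {d : ℕ} (M : H →* Matrix (Fin d) (Fin d) ℂ) :
    Representation ℂ H (Fin d → ℂ) :=
  (Matrix.toLinAlgEquiv' : Matrix (Fin d) (Fin d) ℂ ≃ₐ[ℂ] _).toAlgHom.toRingHom.toMonoidHom.comp M

lemma repOf_apply {H : Type} [Group H] {d : ℕ} (M : H →* Matrix (Fin d) (Fin d) ℂ) (g : H) :
    repOf M g = Matrix.toLin' (M g) := rfl

lemma char_repOf {H : Type} [Group H] {d : ℕ} (M : H →* Matrix (Fin d) (Fin d) ℂ) (g : H) :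
    (FDRep.of (repOf M)).character g = Matrix.trace (M g) := by
  have : (FDRep.of (repOf M)).character g = LinearMap.trace ℂ (Fin d → ℂ) (Matrix.toLin' (M g)) := rfl
  rw [this, Matrix.trace_toLin'_eq]

lemma isCh_of_rep {H : Type} [Group H] {W : Type} [AddCommGroup W] [Module ℂ W]
    [FiniteDimensional ℂ W] (ρ : H →* (W →ₗ[ℂ] W)) (d : ℕ) (hd : finrank ℂ W = d) :
    IsCh H (fun g => LinearMap.trace ℂ W (ρ g)) d := by
  let b := finBasisOfFinrankEq ℂ W hd
  refine ⟨(LinearMap.toMatrixAlgEquiv b).toAlgHom.toRingHom.toMonoidHom.comp ρ, fun g => ?_⟩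
  exact LinearMap.trace_eq_matrix_trace ℂ b (ρ g)

lemma irr_iff {H : Type} [Group H] [Fintype H] (χ : H → ℂ) (d : ℕ) :
    IsIrrCharDeg H χ d ↔ IsCh H χ d ∧ ∑ g, χ g * χ g⁻¹ = Nat.card H := by
  constructor
  · rintro ⟨V, hV, rfl, hd⟩
    exact ⟨isCh_of_rep V.ρ d hd, (FDRep.simple_iff_char_is_norm_one V).1 hV⟩
  · rintro ⟨⟨M, hM⟩, hn⟩
    have h : χ = (FDRep.of (repOf M)).character := by
      ext g; rw [char_repOf, hM]
    refine ⟨FDRep.of (repOf M), ?_, h, ?_⟩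
    · rw [FDRep.simple_iff_char_is_norm_one, ← h, hn]
    · exact Module.finrank_fin_fun ℂ

lemma IsCh.one {H : Type} [Group H] {χ : H → ℂ} {d : ℕ} (h : IsCh H χ d) : χ 1 = d := by
  obtain ⟨M, hM⟩ := h
  simp [hM]

lemma IsCh.comp {H K : Type} [Group H] [Group K] {χ : K → ℂ} {d : ℕ} (h : IsCh K χ d)
    (φ : H →* K) : IsCh H (fun x => χ (φ x)) d := by
  obtain ⟨M, hM⟩ := h
  exact ⟨M.comp φ, fun g => hM _⟩

lemma IsCh.conj {H : Type} [Group H] {χ : H → ℂ} {d : ℕ} (h : IsCh H χ d) (x g : H) :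
    χ (x * g * x⁻¹) = χ g := by
  obtain ⟨M, hM⟩ := h
  rw [hM, hM, map_mul, Matrix.trace_mul_comm, ← map_mul, inv_mul_cancel_left]

lemma IsCh.mul {H : Type} [Group H] {χ ψ : H → ℂ} {d e : ℕ} (h : IsCh H χ d) (h' : IsCh H ψ e) :
    IsCh H (fun x => χ x * ψ x) (d * e) := by
  obtain ⟨M, hM⟩ := h
  obtain ⟨N, hN⟩ := h'
  have := isCh_of_rep (Representation.tprod (repOf M) (repOf N)) (d * e) (by simp)
  convert this using 2 with g
  rw [Representation.tprod_apply, LinearMap.trace_tensorProduct', repOf_apply, repOf_apply,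
    Matrix.trace_toLin'_eq, Matrix.trace_toLin'_eq, hM, hN]

lemma isCh_hom {H : Type} [Group H] (f : H →* ℂ) : IsCh H f 1 := by
  refine ⟨(Matrix.scalar (Fin 1)).toMonoidHom.comp f, fun g => by simp⟩

lemma irr_hom {H : Type} [Group H] [Fintype H] (f : H →* ℂ) : IsIrrCharDeg H f 1 := by
  rw [irr_iff]
  refine ⟨isCh_hom f, ?_⟩
  have h : ∀ g, f g * f g⁻¹ = 1 := fun g => by rw [← map_mul, mul_inv_cancel, map_one]
  simp only [h]
  simp

lemma IsCh.exists_hom {H : Type} [Group H] {χ : H → ℂ} (h : IsCh H χ 1) :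
    ∃ f : H →* ℂ, χ = f := by
  obtain ⟨M, hM⟩ := h
  refine ⟨⟨⟨χ, by simp [hM]⟩, ?_⟩, rfl⟩
  intro x y
  simp [hM, Matrix.mul_apply, Matrix.trace_fin_one]

/-- Schur -/
lemma schur {H : Type} [Group H] [Fintype H] {d : ℕ} (M : H →* Matrix (Fin d) (Fin d) ℂ)
    (hn : ∑ g, Matrix.trace (M g) * Matrix.trace (M g⁻¹) = Nat.card H)
    (X : Matrix (Fin d) (Fin d) ℂ) (hX : ∀ g, X * M g = M g * X) :
    ∃ c : ℂ, X = c • (1 : Matrix (Fin d) (Fin d) ℂ) := by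
  have hs : Simple (FDRep.of (repOf M)) := by
    rw [FDRep.simple_iff_char_is_norm_one]
    simp_rw [char_repOf]; exact hn
  have h1 := finrank_endomorphism_simple_eq_one ℂ (FDRep.of (repOf M))
  let T : FDRep.of (repOf M) ⟶ FDRep.of (repOf M) :=
    ⟨InducedCategory.homMk (ModuleCat.ofHom (Matrix.toLin' X)), fun g => by
      ext1
      change Matrix.toLin' X ∘ₗ Matrix.toLin' (M g) = Matrix.toLin' (M g) ∘ₗ Matrix.toLin' X
      rw [← Matrix.toLin'_mul, ← Matrix.toLin'_mul, hX]⟩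
  obtain ⟨c, hc⟩ := (finrank_eq_one_iff_of_nonzero' (𝟙 (FDRep.of (repOf M))) (id_nonzero _)).1 h1 T
  refine ⟨c, ?_⟩
  have h2 : (c • (𝟙 (FDRep.of (repOf M)) : FDRep.of (repOf M) ⟶ _)).hom.hom.hom = T.hom.hom.hom := by
    rw [hc]
  have h3 : c • (LinearMap.id : (Fin d → ℂ) →ₗ[ℂ] _) = Matrix.toLin' X := h2
  apply Matrix.toLin'.injective
  rw [← h3, map_smul, Matrix.toLin'_one]

lemma isCh_sub {H : Type} [Group H] [Fintype H] {χ ψ : H → ℂ} {a b c : ℕ} (h : IsCh H χ a)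
    (h' : IsIrrCharDeg H ψ b) (hne : ∑ g, χ g * ψ g⁻¹ ≠ 0) (hc : c + b = a) :
    IsCh H (fun g => χ g - ψ g) c := by
  obtain ⟨M, hM⟩ := h
  obtain ⟨V, hV, rfl, hb⟩ := h'
  obtain ⟨X, rfl, hXr⟩ : ∃ X : FDRep ℂ H, χ = X.character ∧ finrank ℂ X = a :=
    ⟨FDRep.of (repOf M), by ext g; rw [char_repOf, hM], Module.finrank_fin_fun ℂ⟩
  have := invertibleOfNonzero (NeZero.ne (Nat.card H : ℂ))
  have h1 := FDRep.scalar_product_char_eq_finrank_equivariant V X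
  have h2 : finrank ℂ (V ⟶ X) ≠ 0 := by
    intro h0
    rw [h0] at h1
    have := NeZero.ne (Nat.card H : ℂ)
    simp_all
  obtain ⟨φ, hφ⟩ : ∃ g : V ⟶ X, g ≠ 0 :=
    (Module.finrank_pos_iff_exists_ne_zero (R := ℂ)).mp (by omega)
  have := mono_of_nonzero_from_simple hφ
  let ψ := Injective.factorThru (𝟙 V) φ
  have hψ : φ ≫ ψ = 𝟙 V := Injective.comp_factorThru (𝟙 _) φ
  let F : V →ₗ[ℂ] X := φ.hom.hom.hom
  let P : X →ₗ[ℂ] V := ψ.hom.hom.hom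
  have hPF : P ∘ₗ F = LinearMap.id := congrArg (fun t : V ⟶ V => t.hom.hom.hom) hψ
  have hF : ∀ g, F ∘ₗ V.ρ g = X.ρ g ∘ₗ F := fun g =>
    congrArg (fun t : V.V ⟶ X.V => t.hom.hom) (φ.comm g)
  have hP : ∀ g, P ∘ₗ X.ρ g = V.ρ g ∘ₗ P := fun g =>
    congrArg (fun t : X.V ⟶ V.V => t.hom.hom) (ψ.comm g)
  have hPF' : ∀ v, P (F v) = v := fun v => LinearMap.congr_fun hPF v
  have hP' : ∀ g v, P (X.ρ g v) = V.ρ g (P v) := fun g v => LinearMap.congr_fun (hP g) v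
  let W := LinearMap.ker P
  have hW : ∀ g, ∀ v ∈ W, X.ρ g v ∈ W := by
    intro g v hv
    have : P v = 0 := hv
    change P _ = 0
    rw [hP', this, map_zero]
  let σ : H →* (W →ₗ[ℂ] W) :=
    { toFun := fun g => (X.ρ g).restrict (hW g)
      map_one' := by ext; simp
      map_mul' := fun x y => by ext; simp }
  have hfr : finrank ℂ W = c := by
    have hs : Function.Surjective P := fun v => ⟨F v, hPF' v⟩
    have := LinearMap.finrank_range_add_finrank_ker P
    rw [LinearMap.range_eq_top.2 hs, finrank_top] at this
    have e1 : finrank ℂ V = b := hb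
    have e2 : finrank ℂ X = a := hXr
    change _ + finrank ℂ W = _ at this
    omega
  have key := isCh_of_rep σ c hfr
  convert key using 2 with g
  let r : X →ₗ[ℂ] W := LinearMap.codRestrict W (LinearMap.id - F ∘ₗ P) (fun v => by
    change P _ = 0
    simp [hPF'])
  have e1 : σ g = r ∘ₗ (X.ρ g ∘ₗ W.subtype) := by
    ext v
    have : P v = 0 := v.2
    simp [σ, r, hP', this]
  rw [e1, LinearMap.trace_comp_comm']
  have e2 : (X.ρ g ∘ₗ W.subtype) ∘ₗ r = X.ρ g - (X.ρ g ∘ₗ F) ∘ₗ P := by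
    ext v
    simp [r]
  rw [e2, map_sub, LinearMap.trace_comp_comm', ← LinearMap.comp_assoc, hP, LinearMap.comp_assoc, hPF]
  rfl

lemma sum_surj {H K : Type} [Group H] [Group K] [Fintype H] [Fintype K] (m : H →* K)
    (hm : Function.Surjective m) (F : K → ℂ) :
    ∃ n : ℕ, n ≠ 0 ∧ Nat.card H = n * Nat.card K ∧ ∑ h, F (m h) = n * ∑ k, F k := by
  classical
  have hc : ∀ k, (Finset.univ.filter (fun h => m h = k)).card
      = (Finset.univ.filter (fun h => m h = 1)).card := fun k =>
    MonoidHom.card_fiber_eq_of_mem_range m (hm k) (hm 1)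
  have h1 : Nat.card H = (Finset.univ.filter (fun h => m h = 1)).card * Nat.card K := by
    rw [Nat.card_eq_fintype_card, Nat.card_eq_fintype_card, ← Finset.card_univ (α := H),
      Finset.card_eq_sum_card_fiberwise (f := m) (t := Finset.univ) (by simp)]
    simp [hc, mul_comm]
  refine ⟨(Finset.univ.filter (fun h => m h = 1)).card, ?_, h1, ?_⟩
  · intro h0
    rw [h0, zero_mul] at h1
    exact Nat.card_pos.ne' h1
  · rw [← Finset.sum_fiberwise (s := Finset.univ) (g := m), Finset.mul_sum]
    refine Finset.sum_congr rfl fun k _ => ?_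
    rw [Finset.sum_congr rfl (g := fun _ => F k) (by simp +contextual), Finset.sum_const, hc,
      nsmul_eq_mul]

lemma irr_comp_iff {H K : Type} [Group H] [Group K] [Finite H] (m : H →* K)
    (hm : Function.Surjective m) (ψ : K → ℂ) (d : ℕ) (h : IsCh K ψ d) :
    IsIrrCharDeg K ψ d ↔ IsIrrCharDeg H (fun x => ψ (m x)) d := by
  have := Finite.of_surjective m hm
  cases nonempty_fintype H
  cases nonempty_fintype K
  rw [irr_iff, irr_iff]
  obtain ⟨n, hn, h1, h2⟩ := sum_surj m hm (fun k => ψ k * ψ k⁻¹)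
  simp only [h, h.comp m, true_and, map_inv, h1, h2]
  push_cast
  rw [mul_right_inj' (by exact_mod_cast hn)]

lemma IsIrrCharDeg.isCh {H : Type} [Group H] [Finite H] {χ : H → ℂ} {d : ℕ}
    (h : IsIrrCharDeg H χ d) : IsCh H χ d := by
  cases nonempty_fintype H
  exact ((irr_iff _ _).1 h).1

lemma IsIrrCharDeg.ne_zero {H : Type} [Group H] [Finite H] {χ : H → ℂ} {d : ℕ}
    (h : IsIrrCharDeg H χ d) : d ≠ 0 := by
  cases nonempty_fintype H
  rw [irr_iff] at h
  rintro rfl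
  obtain ⟨⟨M, hM⟩, h⟩ := h
  simp [hM] at h
  exact Fintype.card_ne_zero (Nat.cast_eq_zero.1 h.symm)

/-- central elements act as scalars -/
lemma irr_scalar {H : Type} [Group H] [Finite H] {χ : H → ℂ} {d : ℕ}
    (h : IsIrrCharDeg H χ d) : ∃ M : H →* Matrix (Fin d) (Fin d) ℂ,
    (∀ g, χ g = Matrix.trace (M g)) ∧
    ∀ X : Matrix (Fin d) (Fin d) ℂ, (∀ g, X * M g = M g * X) →
      X = (X.trace / d) • (1 : Matrix (Fin d) (Fin d) ℂ) := by
  have hd := h.ne_zero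
  cases nonempty_fintype H
  rw [irr_iff] at h
  obtain ⟨⟨M, hM⟩, h⟩ := h
  refine ⟨M, hM, fun X hX => ?_⟩
  simp only [hM] at h
  obtain ⟨c, rfl⟩ := schur M h X hX
  have : (d : ℂ) ≠ 0 := by exact_mod_cast hd
  simp [this]

lemma descend {H K : Type} [Group H] [Group K] [Finite H] (m : H →* K)
    (hm : Function.Surjective m) (χ : H → ℂ) (d : ℕ) (h : IsIrrCharDeg H χ d)
    (hk : ∀ x, m x = 1 → x ∈ Subgroup.center H ∧ χ x = d) :
    ∃ ψ, IsIrrCharDeg K ψ d ∧ (fun x => ψ (m x)) = χ := by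
  have hd : (d : ℂ) ≠ 0 := by exact_mod_cast h.ne_zero
  obtain ⟨M, hM, hs⟩ := irr_scalar h
  have hker : ∀ x ∈ m.ker, M x = 1 := by
    intro x hx
    obtain ⟨h1, h2⟩ := hk x hx
    rw [hs (M x) (fun g => by rw [← map_mul, ← map_mul, Subgroup.mem_center_iff.1 h1]), ← hM, h2,
      div_self hd, one_smul]
  let N : K →* Matrix (Fin d) (Fin d) ℂ :=
    (QuotientGroup.lift m.ker M hker).comp
      (QuotientGroup.quotientKerEquivOfSurjective m hm).symm.toMonoidHom
  have hN : ∀ x, N (m x) = M x := by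
    intro x
    have : (QuotientGroup.quotientKerEquivOfSurjective m hm).symm (m x) = (x : H ⧸ m.ker) := by
      rw [MulEquiv.symm_apply_eq]; rfl
    simp only [N, MonoidHom.comp_apply, MulEquiv.coe_toMonoidHom, this]
    rfl
  have e : (fun x => (fun k => Matrix.trace (N k)) (m x)) = χ := by
    ext x; simp only [hN, hM]
  refine ⟨fun k => Matrix.trace (N k), ?_, e⟩
  rw [irr_comp_iff m hm _ _ ⟨N, fun _ => rfl⟩, e]
  exact h

lemma nChars_quot {H K : Type} [Group H] [Group K] [Finite H] (m : H →* K)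
    (hm : Function.Surjective m) (d : ℕ) (hk : ∀ x, m x = 1 → x ∈ Subgroup.center H) :
    nChars K d = {χ : H → ℂ | IsIrrCharDeg H χ d ∧ ∀ x, m x = 1 → χ x = d}.ncard := by
  have := Finite.of_surjective m hm
  have : {χ : H → ℂ | IsIrrCharDeg H χ d ∧ ∀ x, m x = 1 → χ x = d} =
      (fun (ψ : K → ℂ) (x : H) => ψ (m x)) '' {ψ : K → ℂ | IsIrrCharDeg K ψ d} := by
    ext χ
    constructor
    · rintro ⟨h1, h2⟩
      obtain ⟨ψ, hψ, e⟩ := descend m hm χ d h1 (fun x hx => ⟨hk x hx, h2 x hx⟩)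
      exact ⟨ψ, hψ, e⟩
    · rintro ⟨ψ, hψ : IsIrrCharDeg K ψ d, rfl⟩
      refine ⟨(irr_comp_iff m hm ψ d hψ.isCh).1 hψ, fun x hx => ?_⟩
      simp only [hx, hψ.isCh.one]
  rw [this, Set.ncard_image_of_injective]
  · rfl
  · intro a b hab
    ext k
    obtain ⟨x, rfl⟩ := hm k
    exact congrFun hab x

lemma irr_finite (H : Type) [Group H] [Finite H] (d : ℕ) :
    {χ : H → ℂ | IsIrrCharDeg H χ d}.Finite := by
  cases nonempty_fintype H
  have : LinearIndependent ℂ (fun χ : {χ : H → ℂ | IsIrrCharDeg H χ d} => (χ : H → ℂ)) := by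
    rw [linearIndependent_iff']
    intro s c hc ⟨i, hi⟩ his
    have orth : ∀ j : {χ : H → ℂ | IsIrrCharDeg H χ d}, j ≠ ⟨i, hi⟩ →
        ∑ g, (j : H → ℂ) g * i g⁻¹ = 0 := by
      rintro ⟨j, hj⟩ hne'
      have hne : j ≠ i := fun e => hne' (Subtype.ext e)
      clear hne'
      change ∑ g, j g * i g⁻¹ = 0
      clear hc
      obtain ⟨V, hV, rfl, -⟩ := hi
      obtain ⟨W, hW, rfl, -⟩ := hj
      have := invertibleOfNonzero (NeZero.ne (Nat.card H : ℂ))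
      have h := FDRep.char_orthonormal W V
      rw [if_neg] at h
      · simpa using h
      · rintro ⟨e⟩
        exact hne (FDRep.char_iso e)
    have h2 : ∑ g, (∑ j ∈ s, c j • (j : H → ℂ)) g * i g⁻¹ = c ⟨i, hi⟩ * Nat.card H := by
      simp only [Finset.sum_apply, Pi.smul_apply, smul_eq_mul, Finset.sum_mul]
      rw [Finset.sum_comm]
      rw [Finset.sum_eq_single_of_mem _ his]
      · simp only [mul_assoc]
        rw [← Finset.mul_sum, ((irr_iff _ _).1 hi).2]
      · intro j _ hj
        simp only [mul_assoc]
        rw [← Finset.mul_sum, orth j hj, mul_zero]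
    rw [hc] at h2
    simpa using h2.symm
  exact Set.finite_coe_iff.1 this.finite

/-- external product of class functions -/
def boxp {A B : Type} (p : (A → ℂ) × (B → ℂ)) : A × B → ℂ := fun x => p.1 x.1 * p.2 x.2

lemma irr_ext {A B : Type} [Group A] [Group B] [Finite A] [Finite B] {α : A → ℂ} {γ : B → ℂ}
    {a b : ℕ} (hα : IsIrrCharDeg A α a) (hγ : IsIrrCharDeg B γ b) :
    IsIrrCharDeg (A × B) (boxp (α, γ)) (a * b) := by
  cases nonempty_fintype A
  cases nonempty_fintype B
  rw [irr_iff] at *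
  refine ⟨(hα.1.comp (MonoidHom.fst A B)).mul (hγ.1.comp (MonoidHom.snd A B)), ?_⟩
  rw [Fintype.sum_prod_type]
  simp only [boxp, Prod.fst_inv, Prod.snd_inv]
  rw [Nat.card_prod, Nat.cast_mul, ← hα.2, ← hγ.2, Finset.sum_mul_sum]
  refine Finset.sum_congr rfl fun _ _ => Finset.sum_congr rfl fun _ _ => by ring

lemma ext_injOn {A B : Type} [Group A] [Group B] (a b : ℂ) (ha : a ≠ 0) (hb : b ≠ 0) :
    Set.InjOn (boxp : (A → ℂ) × (B → ℂ) → _) {p | p.1 1 = a ∧ p.2 1 = b} := by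
  rintro ⟨α, γ⟩ ⟨h1, h2⟩ ⟨α', γ'⟩ ⟨h1', h2'⟩ h
  simp only at h1 h2 h1' h2'
  congr 1
  · ext x
    have := congrFun h (x, 1)
    simpa [boxp, h2, h2', hb] using this
  · ext x
    have := congrFun h (1, x)
    simpa [boxp, h1, h1', ha] using this

lemma ext_ncard {A B : Type} [Group A] [Group B] [Finite A] [Finite B] (a b : ℕ)
    (X : Set (A → ℂ)) (Y : Set (B → ℂ)) (hX : ∀ α ∈ X, IsIrrCharDeg A α a)
    (hY : ∀ γ ∈ Y, IsIrrCharDeg B γ b) : (boxp '' (X ×ˢ Y)).ncard = X.ncard * Y.ncard := by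
  rcases X.eq_empty_or_nonempty with rfl | ⟨α, hα⟩
  · simp
  rcases Y.eq_empty_or_nonempty with rfl | ⟨γ, hγ⟩
  · simp
  have ha : (a : ℂ) ≠ 0 := by exact_mod_cast (hX α hα).ne_zero
  have hb : (b : ℂ) ≠ 0 := by exact_mod_cast (hY γ hγ).ne_zero
  rw [Set.InjOn.ncard_image, Set.ncard_prod]
  apply (ext_injOn (a : ℂ) (b : ℂ) ha hb).mono
  rintro ⟨x, y⟩ ⟨hx, hy⟩
  exact ⟨(hX x hx).isCh.one, (hY y hy).isCh.one⟩

abbrev S5 := Matrix.SpecialLinearGroup (Fin 2) (ZMod 5)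

def mk5 (a b c d : ZMod 5) (h : a * d - b * c = 1) : S5 :=
  ⟨!![a, b; c, d], by rw [Matrix.det_fin_two_of]; exact h⟩

/-- the class index -/
def cls (a b c d : ZMod 5) : Fin 9 :=
  if a + d = 0 then 2 else if a + d = 4 then 3 else if a + d = 1 then 4
  else if a + d = 2 then
    if b = 0 ∧ c = 0 then 0 else if b = 1 ∨ b = 4 ∨ c = 1 ∨ c = 4 then 5 else 6
  else
    if b = 0 ∧ c = 0 then 1 else if b = 1 ∨ b = 4 ∨ c = 1 ∨ c = 4 then 7 else 8

/-- representatives -/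
def rp : Fin 9 → S5
  | 0 => mk5 1 0 0 1 (by decide) | 1 => mk5 4 0 0 4 (by decide) | 2 => mk5 0 1 4 0 (by decide)
  | 3 => mk5 0 1 4 4 (by decide) | 4 => mk5 0 4 1 1 (by decide) | 5 => mk5 1 1 0 1 (by decide)
  | 6 => mk5 1 2 0 1 (by decide) | 7 => mk5 4 4 0 4 (by decide) | 8 => mk5 4 3 0 4 (by decide)

def clsS (g : S5) : Fin 9 := cls (g 0 0) (g 0 1) (g 1 0) (g 1 1)

def cnt : Fin 9 → ℕ | 0 => 1 | 1 => 1 | 2 => 30 | 3 => 20 | 4 => 20 | _ => 12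

set_option maxRecDepth 100000

lemma cntS : ∀ i, (Finset.univ.filter (fun x : S5 => clsS x = i)).card = cnt i := by
  decide +kernel

lemma conjS : ∀ g : S5, ∃ h : S5, h * rp (clsS g) = g * h := by
  decide +kernel

lemma prodS : ∀ g : S5, ∃ w : S5, clsS w = 2 ∧ clsS (w⁻¹ * g) = 2 := by
  decide +kernel

lemma clsInv : ∀ g : S5, clsS g⁻¹ = clsS g := by
  decide +kernel

lemma cls_rp : ∀ i, clsS (rp i) = i := by decide +kernel

lemma card_S5 : Fintype.card S5 = 120 := by decide +kernel

lemma centerS : ∀ g : S5, (∀ h, h * g = g * h) → g = 1 ∨ g = rp 1 := by decide +kernel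

lemma central1 : ∀ g : S5, g * rp 1 = rp 1 * g := by decide +kernel

lemma rp0 : rp 0 = 1 := by decide +kernel
lemma rp11 : rp 1 * rp 1 = 1 := by decide +kernel
lemma rp2 : rp 2 * rp 2 = rp 1 := by decide +kernel
lemma rp3 : rp 3 * rp 3 * rp 3 = 1 := by decide +kernel
lemma rp4 : rp 4 = rp 1 * rp 3 := by decide +kernel
lemma rp5 : rp 5 * rp 5 * rp 5 * rp 5 * rp 5 = 1 := by decide +kernel
lemma rp6 : rp 6 = rp 5 * rp 5 := by decide +kernel
lemma rp7 : rp 7 = rp 1 * rp 5 := by decide +kernel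
lemma rp8 : rp 8 = rp 1 * (rp 5 * rp 5) := by decide +kernel
lemma norm3 : ∃ h : S5, clsS (rp 3 * h * rp 3 * h⁻¹) = 2 := by decide +kernel
lemma norm5 : ∃ h : S5, clsS (rp 5 * h * (rp 5 * rp 5) * h⁻¹) = 2 := by decide +kernel
lemma rp10 : rp 1 ≠ 1 := by decide +kernel
lemma sq2 : ∀ w : S5, clsS w = 2 → w * w = rp 1 := by decide +kernel

lemma comm_triv {Q : Type} [Monoid Q] (N : S5 →* Q) (hc : ∀ h, N h * N (rp 2) = N (rp 2) * N h)
    (g : S5) : N g = 1 := by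
  have h2 : ∀ w, clsS w = 2 → N w = N (rp 2) := by
    intro w hw
    obtain ⟨h, hh⟩ := conjS w
    rw [hw] at hh
    have : w = h * rp 2 * h⁻¹ := by rw [hh]; group
    rw [this, map_mul, map_mul, hc, mul_assoc, ← map_mul, mul_inv_cancel, map_one, mul_one]
  have h3 : ∀ g, N g = N (rp 2) * N (rp 2) := by
    intro g
    obtain ⟨w, hw, hw'⟩ := prodS g
    rw [← h2 _ hw]
    nth_rewrite 2 [h2 _ hw]
    rw [← h2 _ hw', ← map_mul, mul_inv_cancel_left]
  rw [h3, ← h3 1, map_one]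

lemma perfectS (φ : S5 →* ℂ) (g : S5) : φ g = 1 := comm_triv φ (fun _ => mul_comm _ _) g

lemma charS {χ : S5 → ℂ} {d : ℕ} (h : IsCh S5 χ d) (g : S5) : χ g = χ (rp (clsS g)) := by
  obtain ⟨x, hx⟩ := conjS g
  have : g = x * rp (clsS g) * x⁻¹ := by rw [hx]; group
  conv_lhs => rw [this]
  exact h.conj _ _

lemma sumS (F : S5 → ℂ) (hF : ∀ g, F g = F (rp (clsS g))) :
    ∑ g, F g = F (rp 0) + F (rp 1) + 30 * F (rp 2) + 20 * F (rp 3) + 20 * F (rp 4) +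
      12 * (F (rp 5) + F (rp 6) + F (rp 7) + F (rp 8)) := by
  have : ∑ g, F g = ∑ i : Fin 9, (cnt i : ℂ) * F (rp i) := by
    rw [← Finset.sum_fiberwise (s := Finset.univ) (g := clsS)]
    refine Finset.sum_congr rfl fun i _ => ?_
    rw [← cntS i, ← nsmul_eq_mul, ← Finset.sum_const]
    refine Finset.sum_congr rfl fun g hg => ?_
    rw [hF g, (Finset.mem_filter.1 hg).2]
  rw [this]
  simp only [Fin.sum_univ_succ, Fin.sum_univ_zero]
  have e : (Fin.succ 0 : Fin 9) = 1 := rfl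
  change (((1 : ℕ) : ℂ) * F (rp 0) + (((1 : ℕ) : ℂ) * F (rp 1) + (((30 : ℕ) : ℂ) * F (rp 2) +
    (((20 : ℕ) : ℂ) * F (rp 3) + (((20 : ℕ) : ℂ) * F (rp 4) + (((12 : ℕ) : ℂ) * F (rp 5) +
    (((12 : ℕ) : ℂ) * F (rp 6) + (((12 : ℕ) : ℂ) * F (rp 7) + (((12 : ℕ) : ℂ) * F (rp 8) + 0))))))))) = _
  push_cast
  ring

lemma innerS {χ ψ : S5 → ℂ} {d e : ℕ} (h : IsCh S5 χ d) (h' : IsCh S5 ψ e) :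
    ∑ g, χ g * ψ g⁻¹ = χ (rp 0) * ψ (rp 0) + χ (rp 1) * ψ (rp 1) + 30 * (χ (rp 2) * ψ (rp 2))
      + 20 * (χ (rp 3) * ψ (rp 3)) + 20 * (χ (rp 4) * ψ (rp 4)) +
      12 * (χ (rp 5) * ψ (rp 5) + χ (rp 6) * ψ (rp 6) + χ (rp 7) * ψ (rp 7)
        + χ (rp 8) * ψ (rp 8)) := by
  rw [← sumS (fun g => χ g * ψ g)]
  · refine Finset.sum_congr rfl fun g _ => ?_
    rw [charS h' g⁻¹, clsInv, ← charS h']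
  · intro g
    rw [charS h g, charS h' g]

lemma irrS {χ : S5 → ℂ} {d : ℕ} (h : IsCh S5 χ d) : IsIrrCharDeg S5 χ d ↔
    χ (rp 0) * χ (rp 0) + χ (rp 1) * χ (rp 1) + 30 * (χ (rp 2) * χ (rp 2))
      + 20 * (χ (rp 3) * χ (rp 3)) + 20 * (χ (rp 4) * χ (rp 4)) +
      12 * (χ (rp 5) * χ (rp 5) + χ (rp 6) * χ (rp 6) + χ (rp 7) * χ (rp 7)
        + χ (rp 8) * χ (rp 8)) = 120 := by
  rw [irr_iff, innerS h h, Nat.card_eq_fintype_card, card_S5]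
  simp [h]

structure Tbl (f : S5 → ℂ) (v0 v1 v2 v3 v4 v5 v6 v7 v8 : ℂ) : Prop where
  h0 : f (rp 0) = v0
  h1 : f (rp 1) = v1
  h2 : f (rp 2) = v2
  h3 : f (rp 3) = v3
  h4 : f (rp 4) = v4
  h5 : f (rp 5) = v5
  h6 : f (rp 6) = v6
  h7 : f (rp 7) = v7
  h8 : f (rp 8) = v8

abbrev M2 := Matrix (Fin 2) (Fin 2) ℂ

lemma CH2 (x : M2) (hx : x.det = 1) : x * x = x.trace • x - 1 := by
  rw [Matrix.det_fin_two] at hx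
  ext i j
  fin_cases i <;> fin_cases j <;>
    simp [Matrix.mul_apply, Matrix.trace_fin_two] <;> first | linear_combination (-1 : ℂ) * hx | ring

lemma scal2 (c : ℂ) (hx : (c • (1 : M2)).det = 1) : c = 1 ∨ c = -1 := by
  rw [Matrix.det_smul] at hx
  simpa using hx

lemma inv2 (x : M2) (hx : x.det = 1) (h : x * x = 1) : x = 1 ∨ x = -1 := by
  have h1 := CH2 x hx
  rw [h] at h1
  have h2 : x.trace • x = (2 : ℂ) • (1 : M2) := by
    rw [two_smul]; nth_rewrite 2 [h1]; abel
  have ht : x.trace ≠ 0 := by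
    intro h0
    rw [h0, zero_smul] at h2
    have := congrFun (congrFun h2 0) 0
    simp at this
  have h3 : x = (x.trace⁻¹ * 2) • (1 : M2) := by
    rw [mul_smul, ← h2, smul_smul, inv_mul_cancel₀ ht, one_smul]
  rw [h3] at hx
  rcases scal2 _ hx with h | h
  · left; rw [h3, h, one_smul]
  · right; rw [h3, h, neg_one_smul]

lemma neg_one_ne2 : (-1 : M2) ≠ 1 := by
  intro h
  have := congrFun (congrFun h 0) 0
  simp at this
  norm_num at this

lemma ord2 (x : M2) (hx : x.det = 1) (h : x * x = -1) : x.trace = 0 := by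
  have h1 := CH2 x hx
  rw [h] at h1
  have h2 : x.trace • x = 0 := by simpa [sub_eq_add_neg] using h1.symm
  by_contra h0
  have : x = 0 := (smul_eq_zero.1 h2).resolve_left h0
  simp [this] at hx

lemma ord3 (x : M2) (hx : x.det = 1) (h : x * x * x = 1) (h1 : x ≠ 1) : x.trace = -1 := by
  have h2 := CH2 x hx
  rw [h2, sub_mul, smul_mul_assoc, h2, one_mul] at h
  set t := x.trace
  have h3 : (t * t - 1) • x = (t + 1) • (1 : M2) := by
    rw [add_smul, one_smul]
    nth_rewrite 2 [← h]
    module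
  by_cases h0 : t * t - 1 = 0
  · rw [h0, zero_smul] at h3
    have := congrFun (congrFun h3 0) 0
    simp at this
    linear_combination -this
  · exfalso
    have h4 : x = ((t * t - 1)⁻¹ * (t + 1)) • (1 : M2) := by
      rw [mul_smul, ← h3, smul_smul, inv_mul_cancel₀ h0, one_smul]
    have h5 := hx
    rw [h4] at h5
    rcases scal2 _ h5 with h6 | h6
    · exact h1 (by rw [h4, h6, one_smul])
    · rw [h6, neg_one_smul] at h4
      have ht : t = -2 := by simp [t, h4]
      rw [h4, ht] at h
      have := congrFun (congrFun h 0) 0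
      simp at this
      norm_num at this

lemma ord5 (x : M2) (hx : x.det = 1) (h : x * x * x * x * x = 1) (h1 : x ≠ 1) :
    x.trace ^ 2 + x.trace = 1 := by
  have h2 := CH2 x hx
  have h3 : x * x * x * x * x = x * x * (x * x) * x := by simp only [mul_assoc]
  set t := x.trace with htdef
  have h4 : x * x * (x * x) = (t ^ 3 - 2 * t) • x - (t ^ 2 - 1) • (1 : M2) := by
    rw [h2]
    simp only [sub_mul, mul_sub, smul_mul_assoc, mul_smul_comm, h2, one_mul, mul_one]
    module
  have h5 : x * x * (x * x) * x = (t ^ 4 - 3 * t ^ 2 + 1) • x - (t ^ 3 - 2 * t) • (1 : M2) := by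
    rw [h4]
    simp only [sub_mul, smul_mul_assoc, h2, one_mul]
    module
  rw [h3, h5] at h
  have h6 : (t ^ 4 - 3 * t ^ 2 + 1) • x = (t ^ 3 - 2 * t + 1) • (1 : M2) := by
    rw [add_smul (t ^ 3 - 2 * t), one_smul]
    nth_rewrite 2 [← h]
    module
  by_cases h0 : t ^ 4 - 3 * t ^ 2 + 1 = 0
  · rw [h0, zero_smul] at h6
    have := congrFun (congrFun h6 0) 0
    simp at this
    have e : (t - 1) * (t ^ 2 + t - 1) = 0 := by linear_combination -this
    rcases mul_eq_zero.1 e with e | e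
    · have : t = 1 := by linear_combination e
      rw [this] at h0
      norm_num at h0
    · linear_combination e
  · exfalso
    have h7 : x = ((t ^ 4 - 3 * t ^ 2 + 1)⁻¹ * (t ^ 3 - 2 * t + 1)) • (1 : M2) := by
      rw [mul_smul, ← h6, smul_smul, inv_mul_cancel₀ h0, one_smul]
    have h8 := hx
    rw [h7] at h8
    rcases scal2 _ h8 with h9 | h9
    · exact h1 (by rw [h7, h9, one_smul])
    · rw [h9, neg_one_smul] at h7
      have ht : t = -2 := by simp [htdef, h7]
      rw [h7, ht] at h
      have := congrFun (congrFun h 0) 0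
      simp at this
      norm_num at this

lemma det1 (M : S5 →* M2) (g : S5) : (M g).det = 1 :=
  perfectS (Matrix.detMonoidHom.comp M) g

lemma twoD_cases (M : S5 →* M2) : M (rp 1) = 1 ∨ M (rp 1) = -1 :=
  inv2 _ (det1 M _) (by rw [← map_mul, rp11, map_one])

lemma twoD_triv (M : S5 →* M2) (h : M (rp 1) = 1) (g : S5) : M g = 1 := by
  apply comm_triv
  intro x
  rcases inv2 (M (rp 2)) (det1 M _) (by rw [← map_mul, rp2, h]) with h | h <;> simp [h]

lemma twoD_tbl (M : S5 →* M2) (h : M (rp 1) = -1) :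
    ∃ t : ℂ, t ^ 2 + t = 1 ∧ Tbl (fun g => (M g).trace) 2 (-2) 0 (-1) 1 t (-1 - t) (-t) (1 + t) := by
  have hc2 : ∀ w, clsS w = 2 → M w ≠ 1 := by
    intro w hw h1
    have := congrArg M (sq2 w hw)
    rw [map_mul, h1, h, one_mul] at this
    exact neg_one_ne2 this.symm
  have n3 : M (rp 3) ≠ 1 := by
    intro h1
    obtain ⟨x, hx⟩ := norm3
    apply hc2 _ hx
    rw [map_mul, map_mul, map_mul, h1, one_mul, mul_one, ← map_mul, mul_inv_cancel, map_one]
  have n5 : M (rp 5) ≠ 1 := by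
    intro h1
    obtain ⟨x, hx⟩ := norm5
    apply hc2 _ hx
    rw [map_mul, map_mul, map_mul, map_mul, h1, one_mul, mul_one, mul_one, ← map_mul,
      mul_inv_cancel, map_one]
  have t5 := ord5 (M (rp 5)) (det1 M _) (by simp only [← map_mul, rp5, map_one]) n5
  have t3 := ord3 (M (rp 3)) (det1 M _) (by simp only [← map_mul, rp3, map_one]) n3
  have t2 := ord2 (M (rp 2)) (det1 M _) (by rw [← map_mul, rp2, h])
  have t6 : (M (rp 6)).trace = -1 - (M (rp 5)).trace := by
    rw [rp6, map_mul, CH2 _ (det1 M _), Matrix.trace_sub, Matrix.trace_smul, smul_eq_mul]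
    simp
    linear_combination t5
  refine ⟨(M (rp 5)).trace, t5, ?_, ?_, t2, t3, ?_, rfl, t6, ?_, ?_⟩
  · simp [rp0]
  · simp [h]
  · simp [rp4, h, t3]
  · simp [rp7, h]
  · rw [rp8, ← rp6]
    simp only [map_mul, h, neg_mul, one_mul, Matrix.trace_neg, t6]
    ring

lemma irr_of_tbl {f : S5 → ℂ} {t : ℂ} (hf : IsCh S5 f 2) (ht : t ^ 2 + t = 1)
    (hT : Tbl f 2 (-2) 0 (-1) 1 t (-1 - t) (-t) (1 + t)) : IsIrrCharDeg S5 f 2 := by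
  rw [irrS hf, hT.h0, hT.h1, hT.h2, hT.h3, hT.h4, hT.h5, hT.h6, hT.h7, hT.h8]
  linear_combination 48 * ht

lemma irr_one (H : Type) [Group H] [Finite H] : IsIrrCharDeg H (fun _ => 1) 1 := by
  cases nonempty_fintype H
  exact irr_hom (1 : H →* ℂ)

lemma mk_sub {χ ψ : S5 → ℂ} {a b c : ℕ} (h : IsCh S5 χ a) (h' : IsIrrCharDeg S5 ψ b)
    (hne : χ (rp 0) * ψ (rp 0) + χ (rp 1) * ψ (rp 1) + 30 * (χ (rp 2) * ψ (rp 2))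
      + 20 * (χ (rp 3) * ψ (rp 3)) + 20 * (χ (rp 4) * ψ (rp 4)) +
      12 * (χ (rp 5) * ψ (rp 5) + χ (rp 6) * ψ (rp 6) + χ (rp 7) * ψ (rp 7)
        + χ (rp 8) * ψ (rp 8)) = 120) (hc : c + b = a) :
    IsCh S5 (fun g => χ g - ψ g) c := by
  refine isCh_sub h h' ?_ hc
  rw [innerS h h'.isCh, hne]
  norm_num

lemma exists3 {f : S5 → ℂ} {t : ℂ} (hf : IsCh S5 f 2) (ht : t ^ 2 + t = 1)
    (hT : Tbl f 2 (-2) 0 (-1) 1 t (-1 - t) (-t) (1 + t)) :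
    ∃ f3, IsIrrCharDeg S5 f3 3 ∧ Tbl f3 3 3 (-1) 0 0 (-t) (1 + t) (-t) (1 + t) := by
  have hc : IsCh S5 (fun g => f g * f g - 1) 3 := by
    refine mk_sub (hf.mul hf) (irr_one S5) ?_ rfl
    rw [hT.h0, hT.h1, hT.h2, hT.h3, hT.h4, hT.h5, hT.h6, hT.h7, hT.h8]
    linear_combination 48 * ht
  have hT' : Tbl (fun g => f g * f g - 1) 3 3 (-1) 0 0 (-t) (1 + t) (-t) (1 + t) := by
    constructor <;> simp only [hT.h0, hT.h1, hT.h2, hT.h3, hT.h4, hT.h5, hT.h6, hT.h7, hT.h8] <;>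
      first | norm_num; done | linear_combination ht
  refine ⟨_, ?_, hT'⟩
  rw [irrS hc, hT'.h0, hT'.h1, hT'.h2, hT'.h3, hT'.h4, hT'.h5, hT'.h6, hT'.h7, hT'.h8]
  linear_combination 48 * ht

lemma exists4 {f f3 : S5 → ℂ} {t : ℂ} (hf : IsIrrCharDeg S5 f 2) (ht : t ^ 2 + t = 1)
    (hT : Tbl f 2 (-2) 0 (-1) 1 t (-1 - t) (-t) (1 + t)) (hf3 : IsCh S5 f3 3)
    (hT3 : Tbl f3 3 3 (-1) 0 0 (-t) (1 + t) (-t) (1 + t)) :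
    ∃ f4, IsIrrCharDeg S5 f4 4 ∧ Tbl f4 4 (-4) 0 1 (-1) (-1) (-1) 1 1 := by
  have hc : IsCh S5 (fun g => f g * f3 g - f g) 4 := by
    refine mk_sub (hf.isCh.mul hf3) hf ?_ rfl
    rw [hT.h0, hT.h1, hT.h2, hT.h3, hT.h4, hT.h5, hT.h6, hT.h7, hT.h8,
      hT3.h0, hT3.h1, hT3.h2, hT3.h3, hT3.h4, hT3.h5, hT3.h6, hT3.h7, hT3.h8]
    grind
  have hT' : Tbl (fun g => f g * f3 g - f g) 4 (-4) 0 1 (-1) (-1) (-1) 1 1 := by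
    constructor <;> simp only [hT.h0, hT.h1, hT.h2, hT.h3, hT.h4, hT.h5, hT.h6, hT.h7, hT.h8,
      hT3.h0, hT3.h1, hT3.h2, hT3.h3, hT3.h4, hT3.h5, hT3.h6, hT3.h7, hT3.h8] <;> grind
  refine ⟨_, ?_, hT'⟩
  rw [irrS hc, hT'.h0, hT'.h1, hT'.h2, hT'.h3, hT'.h4, hT'.h5, hT'.h6, hT'.h7, hT'.h8]
  norm_num

lemma exists5 {f f3 f4 : S5 → ℂ} {t : ℂ} (hf : IsIrrCharDeg S5 f 2) (ht : t ^ 2 + t = 1)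
    (hT : Tbl f 2 (-2) 0 (-1) 1 t (-1 - t) (-t) (1 + t)) (hf3 : IsIrrCharDeg S5 f3 3)
    (hT3 : Tbl f3 3 3 (-1) 0 0 (-t) (1 + t) (-t) (1 + t))
    (hf4 : IsCh S5 f4 4) (hT4 : Tbl f4 4 (-4) 0 1 (-1) (-1) (-1) 1 1) :
    ∃ f5, IsIrrCharDeg S5 f5 5 ∧ Tbl f5 5 5 1 (-1) (-1) 0 0 0 0 := by
  have hc : IsCh S5 (fun g => f g * f4 g - f3 g) 5 := by
    refine mk_sub (hf.isCh.mul hf4) hf3 ?_ rfl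
    rw [hT.h0, hT.h1, hT.h2, hT.h3, hT.h4, hT.h5, hT.h6, hT.h7, hT.h8,
      hT3.h0, hT3.h1, hT3.h2, hT3.h3, hT3.h4, hT3.h5, hT3.h6, hT3.h7, hT3.h8,
      hT4.h0, hT4.h1, hT4.h2, hT4.h3, hT4.h4, hT4.h5, hT4.h6, hT4.h7, hT4.h8]
    grind
  have hT' : Tbl (fun g => f g * f4 g - f3 g) 5 5 1 (-1) (-1) 0 0 0 0 := by
    constructor <;> simp only [hT.h0, hT.h1, hT.h2, hT.h3, hT.h4, hT.h5, hT.h6, hT.h7, hT.h8,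
      hT3.h0, hT3.h1, hT3.h2, hT3.h3, hT3.h4, hT3.h5, hT3.h6, hT3.h7, hT3.h8,
      hT4.h0, hT4.h1, hT4.h2, hT4.h3, hT4.h4, hT4.h5, hT4.h6, hT4.h7, hT4.h8] <;> grind
  refine ⟨_, ?_, hT'⟩
  rw [irrS hc, hT'.h0, hT'.h1, hT'.h2, hT'.h3, hT'.h4, hT'.h5, hT'.h6, hT'.h7, hT'.h8]
  norm_num

lemma exists6 {f f4 f5 : S5 → ℂ} {t : ℂ} (hf : IsIrrCharDeg S5 f 2) (ht : t ^ 2 + t = 1)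
    (hT : Tbl f 2 (-2) 0 (-1) 1 t (-1 - t) (-t) (1 + t))
    (hf4 : IsIrrCharDeg S5 f4 4) (hT4 : Tbl f4 4 (-4) 0 1 (-1) (-1) (-1) 1 1)
    (hf5 : IsCh S5 f5 5) (hT5 : Tbl f5 5 5 1 (-1) (-1) 0 0 0 0) :
    ∃ f6, IsIrrCharDeg S5 f6 6 ∧ f6 (rp 1) = -6 := by
  have hc : IsCh S5 (fun g => f g * f5 g - f4 g) 6 := by
    refine mk_sub (hf.isCh.mul hf5) hf4 ?_ rfl
    rw [hT.h0, hT.h1, hT.h2, hT.h3, hT.h4, hT.h5, hT.h6, hT.h7, hT.h8,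
      hT5.h0, hT5.h1, hT5.h2, hT5.h3, hT5.h4, hT5.h5, hT5.h6, hT5.h7, hT5.h8,
      hT4.h0, hT4.h1, hT4.h2, hT4.h3, hT4.h4, hT4.h5, hT4.h6, hT4.h7, hT4.h8]
    grind
  refine ⟨fun g => f g * f5 g - f4 g, ?_, ?_⟩
  · rw [irrS hc, hT.h0, hT.h1, hT.h2, hT.h3, hT.h4, hT.h5, hT.h6, hT.h7, hT.h8,
      hT5.h0, hT5.h1, hT5.h2, hT5.h3, hT5.h4, hT5.h5, hT5.h6, hT5.h7, hT5.h8,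
      hT4.h0, hT4.h1, hT4.h2, hT4.h3, hT4.h4, hT4.h5, hT4.h6, hT4.h7, hT4.h8]
    norm_num
  · simp only [hT.h1, hT5.h1, hT4.h1]
    norm_num

lemma exists4' {f f' : S5 → ℂ} {t : ℂ} (hf : IsCh S5 f 2) (hf' : IsCh S5 f' 2)
    (ht : t ^ 2 + t = 1)
    (hT : Tbl f 2 (-2) 0 (-1) 1 t (-1 - t) (-t) (1 + t))
    (hT' : Tbl f' 2 (-2) 0 (-1) 1 (-1 - t) t (1 + t) (-t)) :
    ∃ f4, IsIrrCharDeg S5 f4 4 ∧ f4 (rp 1) = 4 := by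
  refine ⟨fun g => f g * f' g, ?_, ?_⟩
  · rw [irrS (hf.mul hf'), hT.h0, hT.h1, hT.h2, hT.h3, hT.h4, hT.h5, hT.h6, hT.h7, hT.h8,
      hT'.h0, hT'.h1, hT'.h2, hT'.h3, hT'.h4, hT'.h5, hT'.h6, hT'.h7, hT'.h8]
    grind
  · simp only [hT.h1, hT'.h1]
    norm_num

/-- outer automorphism -/
def outS : S5 →* S5 where
  toFun g := ⟨!![2, 0; 0, 1] * (g : Matrix (Fin 2) (Fin 2) (ZMod 5)) * !![3, 0; 0, 1], by
    rw [Matrix.det_mul, Matrix.det_mul, g.2, Matrix.det_fin_two_of, Matrix.det_fin_two_of]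
    decide⟩
  map_one' := by
    apply Subtype.ext
    change !![2, 0; 0, 1] * (1 : Matrix (Fin 2) (Fin 2) (ZMod 5)) * !![3, 0; 0, 1] = 1
    decide +kernel
  map_mul' g h := by
    apply Subtype.ext
    have : (!![3, 0; 0, 1] * !![2, 0; 0, 1] : Matrix (Fin 2) (Fin 2) (ZMod 5)) = 1 := by decide
    change _ * ((g : Matrix (Fin 2) (Fin 2) (ZMod 5)) * h) * _ = (_ * _ * _) * (_ * _ * _)
    simp only [Matrix.mul_assoc]
    rw [← Matrix.mul_assoc !![3, 0; 0, 1] !![2, 0; 0, 1], this, Matrix.one_mul]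

lemma outS1 : outS (rp 1) = rp 1 := by decide +kernel
lemma outS5 : outS (rp 5) = rp 6 := by decide +kernel

def Sg : Set (S5 → ℂ) := {f | IsIrrCharDeg S5 f 2 ∧ f (rp 1) = -2}

lemma sg_tbl {f : S5 → ℂ} (hf : f ∈ Sg) : ∃ t : ℂ, t ^ 2 + t = 1 ∧
    Tbl f 2 (-2) 0 (-1) 1 t (-1 - t) (-t) (1 + t) := by
  obtain ⟨h, h1⟩ := hf
  obtain ⟨M, hM⟩ := h.isCh
  obtain rfl : f = fun g => (M g).trace := funext hM
  apply twoD_tbl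
  rcases twoD_cases M with h2 | h2
  · simp only [h2, Matrix.trace_one] at h1
    norm_num at h1
  · exact h2

lemma sg_eq {f f' : S5 → ℂ} (hf : f ∈ Sg) (hf' : f' ∈ Sg) (h : f (rp 5) = f' (rp 5)) :
    f = f' := by
  obtain ⟨t, ht, hT⟩ := sg_tbl hf
  obtain ⟨t', ht', hT'⟩ := sg_tbl hf'
  obtain rfl : t = t' := by rw [← hT.h5, h, hT'.h5]
  funext g
  rw [charS hf.1.isCh g, charS hf'.1.isCh g]
  generalize clsS g = i
  fin_cases i
  · exact hT.h0.trans hT'.h0.symm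
  · exact hT.h1.trans hT'.h1.symm
  · exact hT.h2.trans hT'.h2.symm
  · exact hT.h3.trans hT'.h3.symm
  · exact hT.h4.trans hT'.h4.symm
  · exact hT.h5.trans hT'.h5.symm
  · exact hT.h6.trans hT'.h6.symm
  · exact hT.h7.trans hT'.h7.symm
  · exact hT.h8.trans hT'.h8.symm

lemma t_ne {t : ℂ} (ht : t ^ 2 + t = 1) : t ≠ -1 - t := by
  intro h
  have h2 : 2 * t = -1 := by linear_combination h
  have : (5 : ℂ) = 0 := by linear_combination (2 * t + 1) * h2 - 4 * ht
  norm_num at this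

lemma sg_out {f : S5 → ℂ} (hf : f ∈ Sg) : (fun g => f (outS g)) ∈ Sg := by
  obtain ⟨M, hM⟩ := hf.1.isCh
  have hc : IsCh S5 (fun g => f (outS g)) 2 := hf.1.isCh.comp outS
  have h1 : f (outS (rp 1)) = -2 := by rw [outS1]; exact hf.2
  refine ⟨?_, h1⟩
  have : (fun g => f (outS g)) = fun g => ((M.comp outS) g).trace := funext fun g => hM _
  have h2 : (M.comp outS) (rp 1) = -1 := by
    rcases twoD_cases (M.comp outS) with h2 | h2
    · rw [hM] at h1
      have h2' : M (outS (rp 1)) = 1 := h2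
      rw [h2', Matrix.trace_one] at h1
      norm_num at h1
    · exact h2
  obtain ⟨t, ht, hT⟩ := twoD_tbl _ h2
  rw [← this] at hT
  exact irr_of_tbl hc ht hT

lemma sg_data {f : S5 → ℂ} (hf : f ∈ Sg) : Sg.ncard = 2 ∧
    (∃ X : Set (S5 → ℂ), X.ncard = 2 ∧ ∀ g ∈ X, IsIrrCharDeg S5 g 3 ∧ g (rp 1) = 3) ∧
    (∃ g, IsIrrCharDeg S5 g 4 ∧ g (rp 1) = 4) ∧
    (∃ g, IsIrrCharDeg S5 g 4 ∧ g (rp 1) = -4) ∧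
    (∃ g, IsIrrCharDeg S5 g 5 ∧ g (rp 1) = 5) ∧
    (∃ g, IsIrrCharDeg S5 g 6 ∧ g (rp 1) = -6) := by
  obtain ⟨t, ht, hT⟩ := sg_tbl hf
  have hf' := sg_out hf
  set f' := fun g => f (outS g) with hf'd
  obtain ⟨t', ht', hT'⟩ := sg_tbl hf'
  have htt : t' = -1 - t := by
    rw [← hT'.h5, hf'd]
    simp only [outS5]; exact hT.h6
  have hne := t_ne ht
  subst htt
  have hT'' : Tbl f' 2 (-2) 0 (-1) 1 (-1 - t) t (1 + t) (-t) := by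
    convert hT' using 1 <;> ring
  refine ⟨?_, ?_, ?_⟩
  · have : Sg = {f, f'} := by
      ext g
      simp only [Set.mem_insert_iff, Set.mem_singleton_iff]
      constructor
      · intro hg
        obtain ⟨s, hs, hS⟩ := sg_tbl hg
        have : (s - t) * (s - (-1 - t)) = 0 := by linear_combination hs - ht
        rcases mul_eq_zero.1 this with h | h
        · left; apply sg_eq hg hf; rw [hS.h5, hT.h5]; linear_combination h
        · right; apply sg_eq hg hf'; rw [hS.h5, hT'.h5]; linear_combination h
      · rintro (rfl | rfl)
        · exact hf
        · exact hf'
    rw [this]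
    apply Set.ncard_pair
    intro h
    apply hne
    exact (hT.h5.symm.trans (congrFun h (rp 5))).trans hT'.h5
  · obtain ⟨a, ha, hA⟩ := exists3 hf.1.isCh ht hT
    obtain ⟨b, hb, hB⟩ := exists3 hf'.1.isCh ht' hT'
    refine ⟨{a, b}, Set.ncard_pair ?_, ?_⟩
    · rintro rfl
      apply hne
      have := hA.h5.symm.trans hB.h5
      linear_combination -this
    · rintro g (rfl | rfl)
      · exact ⟨ha, hA.h1⟩
      · exact ⟨hb, hB.h1⟩
  · obtain ⟨f3, h3, hT3⟩ := exists3 hf.1.isCh ht hT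
    obtain ⟨f4, h4, hT4⟩ := exists4 hf.1 ht hT h3.isCh hT3
    obtain ⟨f5, h5, hT5⟩ := exists5 hf.1 ht hT h3 hT3 h4.isCh hT4
    exact ⟨exists4' hf.1.isCh hf'.1.isCh ht hT hT'', ⟨f4, h4, hT4.h1⟩, ⟨f5, h5, hT5.h1⟩,
      exists6 hf.1 ht hT h4 hT4 h5.isCh hT5⟩

section core
variable {C : Type} [Group C] [Finite C]

/-- decomposition of degree two characters -/
lemma decomp2 (z : C) (χ : S5 × C → ℂ) (h : IsIrrCharDeg (S5 × C) χ 2)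
    (hz : χ (rp 1, z) = 2) :
    (χ (rp 1, 1) = 2 ∧ ∃ γ : C → ℂ, IsIrrCharDeg C γ 2 ∧ γ z = 2 ∧ χ = boxp (fun _ => 1, γ)) ∨
    (χ (rp 1, 1) = -2 ∧ ∃ f ∈ Sg, ∃ γ : C → ℂ, IsIrrCharDeg C γ 1 ∧ γ z = -1 ∧
      χ = boxp (f, γ)) := by
  obtain ⟨M, hM⟩ := h.isCh
  have hsplit : ∀ s c, M (s, c) = M (s, 1) * M (1, c) := fun s c => by
    rw [← map_mul]; simp
  have hcomm : ∀ s c, M (1, c) * M (s, 1) = M (s, 1) * M (1, c) := fun s c => by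
    rw [← map_mul, ← map_mul]; simp
  let N : S5 →* M2 := M.comp (MonoidHom.inl S5 C)
  have hN : ∀ s, N s = M (s, 1) := fun s => rfl
  rcases twoD_cases N with h1 | h1
  · left
    have ht := twoD_triv N h1
    have h2 : χ = boxp (fun _ => 1, fun c => χ (1, c)) := by
      funext ⟨s, c⟩
      simp only [boxp, one_mul]
      rw [hM, hM, hsplit, ← hN, ht, one_mul]
    refine ⟨by rw [hM, ← hN, h1]; simp, fun c => χ (1, c), ?_, ?_, h2⟩
    · refine (irr_comp_iff (MonoidHom.snd S5 C) (fun c => ⟨(1, c), rfl⟩) _ 2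
        (h.isCh.comp (MonoidHom.inr S5 C))).2 ?_
      convert h using 1
      conv_rhs => rw [h2]
      funext x
      simp [boxp]
    · rw [h2] at hz; simpa [boxp] using hz
  · right
    obtain ⟨t, ht, hT⟩ := twoD_tbl N h1
    have hirr : IsIrrCharDeg S5 (fun g => (N g).trace) 2 := irr_of_tbl ⟨N, fun _ => rfl⟩ ht hT
    have hs : ∀ c, ∃ a : ℂ, M (1, c) = a • (1 : M2) := fun c =>
      schur N ((irr_iff _ _).1 hirr).2 _ (fun g => hcomm g c)
    choose l hl using hs
    have hinj : ∀ a b : ℂ, a • (1 : M2) = b • (1 : M2) → a = b := fun a b hab => by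
      simpa using congrFun (congrFun hab 0) 0
    let lam : C →* ℂ :=
      { toFun := l
        map_one' := by
          apply hinj; rw [← hl, one_smul]; exact map_one M
        map_mul' := fun x y => by
          apply hinj
          rw [← hl, mul_smul, ← hl y]
          have : M (1, x * y) = M (1, x) * M (1, y) := by rw [← map_mul]; simp
          rw [this, hl x, smul_mul_assoc, one_mul] }
    have hx : χ = boxp (fun g => (N g).trace, lam) := by
      funext ⟨s, c⟩
      simp only [boxp]
      rw [hM, hsplit, hl, mul_smul_comm, mul_one, Matrix.trace_smul, smul_eq_mul, mul_comm]
      rfl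
    have hr : (N (rp 1)).trace = -2 := hT.h1
    cases nonempty_fintype C
    refine ⟨by rw [hM, ← hN]; exact hr, _, ⟨hirr, hT.h1⟩, lam, irr_hom lam, ?_, hx⟩
    rw [hx] at hz
    simp only [boxp, hr] at hz
    linear_combination (-1/2 : ℂ) * hz

def Np (z : C) (d : ℕ) : Set (S5 × C → ℂ) := {χ | IsIrrCharDeg (S5 × C) χ d ∧ χ (rp 1, z) = d}
def Kp (z : C) (d : ℕ) (e : ℂ) : Set (C → ℂ) := {γ | IsIrrCharDeg C γ d ∧ γ z = e}

lemma Np_fin (z : C) (d : ℕ) : (Np z d).Finite := (irr_finite _ d).subset fun _ h => h.1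
lemma Kp_fin (z : C) (d : ℕ) (e : ℂ) : (Kp z d e).Finite := (irr_finite _ d).subset fun _ h => h.1

lemma box_sub (z : C) {a b d : ℕ} {u v : ℂ} (X : Set (S5 → ℂ))
    (hX : ∀ g ∈ X, IsIrrCharDeg S5 g a ∧ g (rp 1) = u) (hd : a * b = d) (huv : u * v = d) :
    boxp '' (X ×ˢ Kp z b v) ⊆ Np z d ∧
    (boxp '' (X ×ˢ Kp z b v)).ncard = X.ncard * (Kp z b v).ncard := by
  constructor
  · rintro _ ⟨⟨f, γ⟩, ⟨hf, hg⟩, rfl⟩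
    refine ⟨hd ▸ irr_ext (hX f hf).1 hg.1, ?_⟩
    have e1 : f (rp 1) = u := (hX f hf).2
    have e2 : γ z = v := hg.2
    simp only [boxp]
    rw [e1, e2, huv]
  · exact ext_ncard a b _ _ (fun g hg => (hX g hg).1) fun g hg => hg.1

lemma box_le (z : C) {a b d : ℕ} {u v : ℂ} (X : Set (S5 → ℂ))
    (hX : ∀ g ∈ X, IsIrrCharDeg S5 g a ∧ g (rp 1) = u) (hd : a * b = d) (huv : u * v = d) :
    X.ncard * (Kp z b v).ncard ≤ (Np z d).ncard := by
  obtain ⟨h1, h2⟩ := box_sub z X hX hd huv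
  rw [← h2]
  exact Set.ncard_le_ncard h1 (Np_fin z d)

lemma one_sat : ∀ g ∈ ({fun _ => 1} : Set (S5 → ℂ)), IsIrrCharDeg S5 g 1 ∧ g (rp 1) = 1 := by
  rintro _ rfl
  exact ⟨irr_one S5, rfl⟩

lemma N1_card (z : C) : (Np z 1).ncard = (Kp z 1 1).ncard := by
  obtain ⟨h1, h2⟩ := box_sub z (b := 1) (d := 1) (v := 1) _ one_sat rfl (by simp)
  rw [Set.ncard_singleton, one_mul] at h2
  rw [← h2]
  congr 1
  apply Set.Subset.antisymm _ h1
  rintro χ ⟨hχ, hz⟩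
  obtain ⟨f, rfl⟩ := hχ.isCh.exists_hom
  cases nonempty_fintype C
  have hf : ∀ s c, f (s, c) = f (1, c) := fun s c => by
    have : f (s, c) = f (s, 1) * f (1, c) := by rw [← map_mul]; simp
    have h1 : f (s, 1) = 1 := perfectS (f.comp (MonoidHom.inl S5 C)) s
    rw [this, h1, one_mul]
  refine ⟨(fun _ => 1, f.comp (MonoidHom.inr S5 C)), ⟨rfl, irr_hom _, ?_⟩, ?_⟩
  · have : f (1, z) = ((1 : ℕ) : ℂ) := by rw [← hf (rp 1)]; exact hz
    simpa using this
  · funext ⟨s, c⟩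
    simp [boxp, hf s c]

lemma K_le (z : C) {l : C → ℂ} (hl : l ∈ Kp z 1 (-1)) (a b : ℂ) (hab : a * -1 = b) :
    (Kp z 1 a).ncard ≤ (Kp z 1 b).ncard := by
  obtain ⟨h1, h2⟩ := hl
  obtain ⟨l, rfl⟩ := h1.isCh.exists_hom
  cases nonempty_fintype C
  apply Set.ncard_le_ncard_of_injOn (fun γ c => γ c * l c) _ _ (Kp_fin z 1 b)
  · rintro γ ⟨hγ, hγz⟩
    obtain ⟨γ, rfl⟩ := hγ.isCh.exists_hom
    refine ⟨irr_hom (γ * l), ?_⟩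
    simp only
    rw [hγz, h2, hab]
  · intro γ _ γ' _ h
    funext c
    have := congrFun h c
    simp only at this
    have hne : l c ≠ 0 := fun h0 => by
      have : l c * l c⁻¹ = 1 := by rw [← map_mul, mul_inv_cancel, map_one]
      simp [h0] at this
    exact mul_right_cancel₀ hne this

theorem core (z : C) (χ : S5 × C → ℂ) (hχ : χ ∈ Np z 2) (h1 : χ (rp 1, 1) ≠ 2) :
    (Np z 2).ncard = 2 * (Np z 1).ncard + (Kp z 2 2).ncard ∧
    2 * (Np z 1).ncard ≤ (Np z 3).ncard ∧
    2 * (Np z 1).ncard ≤ (Np z 4).ncard ∧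
    (Np z 1).ncard ≤ (Np z 5).ncard ∧
    (Np z 1).ncard ≤ (Np z 6).ncard ∧
    (Kp z 2 2).ncard ≤ (Np z 8).ncard := by
  have hdec : ∃ f ∈ Sg, ∃ l, l ∈ Kp z 1 (-1) := by
    rcases decomp2 z χ hχ.1 (by simpa using hχ.2) with h | ⟨-, f, hf, l, hl, hlz, -⟩
    · exact absurd h.1 h1
    · exact ⟨f, hf, l, hl, hlz⟩
  obtain ⟨f, hf, l, hl⟩ := hdec
  obtain ⟨hS, ⟨X3, hX3, hX3'⟩, ⟨g4, hg4⟩, ⟨k4, hk4⟩, ⟨g5, hg5⟩, ⟨g6, hg6⟩⟩ := sg_data hf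
  have hK : (Kp z 1 (-1)).ncard = (Kp z 1 1).ncard :=
    le_antisymm (K_le z hl _ _ (by norm_num)) (K_le z hl _ _ (by norm_num))
  rw [N1_card]
  have sat : ∀ {g : S5 → ℂ} {d : ℕ} {u : ℂ}, (IsIrrCharDeg S5 g d ∧ g (rp 1) = u) →
      ∀ g' ∈ ({g} : Set (S5 → ℂ)), IsIrrCharDeg S5 g' d ∧ g' (rp 1) = u := by
    rintro g d u h _ rfl; exact h
  have disj : ∀ {P Q : Set (S5 → ℂ)} {R T : Set (C → ℂ)} {u v p q : ℂ},
      (∀ g ∈ P, g (rp 1) = u) → (∀ g ∈ Q, g (rp 1) = v) → (∀ g ∈ R, g 1 = p) →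
      (∀ g ∈ T, g 1 = q) → u * p ≠ v * q → Disjoint (boxp '' (P ×ˢ R)) (boxp '' (Q ×ˢ T)) := by
    intro P Q R T u v p q hP hQ hR hT hne
    rw [Set.disjoint_left]
    rintro _ ⟨⟨a, b⟩, ⟨ha, hb⟩, rfl⟩ ⟨⟨a', b'⟩, ⟨ha', hb'⟩, h⟩
    apply hne
    have := congrFun h (rp 1, 1)
    simp only [boxp] at this
    rw [hP a ha, hR b hb, hQ a' ha', hT b' hb'] at this
    exact this.symm
  have k1 : ∀ {d : ℕ} {e : ℂ}, ∀ g ∈ Kp z d e, g 1 = d := fun g hg => hg.1.isCh.one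
  refine ⟨?_, ?_, ?_, ?_, ?_, ?_⟩
  · obtain ⟨a1, a2⟩ := box_sub z (a := 2) (b := 1) (d := 2) (u := -2) (v := -1) Sg
      (fun g hg => hg) rfl (by norm_num)
    obtain ⟨b1, b2⟩ := box_sub z (b := 2) (d := 2) (v := 2) _ one_sat rfl (by norm_num)
    rw [hS, hK] at a2
    rw [Set.ncard_singleton, one_mul] at b2
    rw [← a2, ← b2, ← Set.ncard_union_eq (disj (fun g hg => hg.2) (fun g hg => (one_sat g hg).2) k1 k1 (by norm_num))
      ((Np_fin z 2).subset a1) ((Np_fin z 2).subset b1)]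
    · congr 1
      apply Set.Subset.antisymm _ (Set.union_subset a1 b1)
      rintro ψ ⟨hψ, hψz⟩
      rcases decomp2 z ψ hψ (by simpa using hψz) with ⟨-, γ, hγ, hγz, rfl⟩ | ⟨-, f, hf, γ, hγ, hγz, rfl⟩
      · right; exact ⟨(fun _ => 1, γ), ⟨rfl, hγ, hγz⟩, rfl⟩
      · left; exact ⟨(f, γ), ⟨hf, hγ, hγz⟩, rfl⟩
  · have := box_le z (b := 1) (d := 3) (v := 1) X3 hX3' rfl (by norm_num)
    rwa [hX3] at this
  · obtain ⟨a1, a2⟩ := box_sub z (b := 1) (d := 4) (v := 1) _ (sat hg4) rfl (by norm_num)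
    obtain ⟨b1, b2⟩ := box_sub z (b := 1) (d := 4) (v := -1) _ (sat hk4) rfl (by norm_num)
    rw [Set.ncard_singleton, one_mul] at a2 b2
    rw [hK] at b2
    rw [two_mul]
    nth_rewrite 1 [← a2]
    rw [← b2, ← Set.ncard_union_eq (disj (fun g hg => (sat hg4 g hg).2) (fun g hg => (sat hk4 g hg).2)
      k1 k1 (by norm_num)) ((Np_fin z 4).subset a1) ((Np_fin z 4).subset b1)]
    exact Set.ncard_le_ncard (Set.union_subset a1 b1) (Np_fin z 4)
  · have := box_le z (b := 1) (d := 5) (v := 1) _ (sat hg5) rfl (by norm_num)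
    rwa [Set.ncard_singleton, one_mul] at this
  · have := box_le z (b := 1) (d := 6) (v := -1) _ (sat hg6) rfl (by norm_num)
    rwa [Set.ncard_singleton, one_mul, hK] at this
  · have := box_le z (b := 2) (d := 8) (v := 2) _ (sat hg4) rfl (by norm_num)
    rwa [Set.ncard_singleton, one_mul] at this

end core

lemma quot_set {H K : Type} [Group H] [Group K] [Finite H] (m : H →* K)
    (hm : Function.Surjective m) (w : H) (hw : w ∈ Subgroup.center H)
    (hk : ∀ x, m x = 1 ↔ x = 1 ∨ x = w) (d : ℕ) :
    nChars K d = {χ : H → ℂ | IsIrrCharDeg H χ d ∧ χ w = d}.ncard := by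
  rw [nChars_quot m hm d]
  · congr 1
    ext χ
    constructor
    · rintro ⟨h1, h2⟩
      exact ⟨h1, h2 w ((hk w).2 (Or.inr rfl))⟩
    · rintro ⟨h1, h2⟩
      refine ⟨h1, fun x hx => ?_⟩
      rcases (hk x).1 hx with rfl | rfl
      · exact h1.isCh.one
      · exact h2
  · intro x hx
    rcases (hk x).1 hx with rfl | rfl
    · exact one_mem _
    · exact hw

/-- Proposition 4.1: let `G = LC` be a central product with `L ≅ SL(2,5)`, amalgamated
central subgroup `Z = Z(L) = L ∩ C`, and `L ≤ G'`.  If `G` has an irreducible character `χ`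
of degree 2 with `Z ⊄ ker χ`, then the stated relations among the `n_d` hold. -/
theorem nChars_central_product_SL25
    (G : Type) [Group G] [Finite G] (L C : Subgroup G)
    (hL : Nonempty (↥L ≃* Matrix.SpecialLinearGroup (Fin 2) (ZMod 5)))
    (hgen : L ⊔ C = ⊤)
    (hcomm : ∀ l ∈ L, ∀ c ∈ C, l * c = c * l)
    (hZ : L ⊓ C = (Subgroup.center ↥L).map L.subtype)
    (hLG' : L ≤ commutator G)
    (χ : G → ℂ) (hχ : IsIrrCharDeg G χ 2)
    (hker : ∃ z ∈ L ⊓ C, χ z ≠ χ 1) :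
    letI : ((L ⊓ C).subgroupOf C).Normal :=
      ⟨by
        intro n hn g
        rw [Subgroup.mem_subgroupOf] at hn ⊢
        have h2 : (g : G) * (n : G) * (g : G)⁻¹ = (n : G) := by
          rw [← hcomm (n : G) hn.1 (g : G) g.2, mul_assoc, mul_inv_cancel, mul_one]
        simpa [h2] using hn⟩
    nChars G 2 = 2 * nChars G 1 + nChars (↥C ⧸ (L ⊓ C).subgroupOf C) 2 ∧
    2 * nChars G 1 ≤ nChars G 3 ∧
    2 * nChars G 1 ≤ nChars G 4 ∧
    nChars G 1 ≤ nChars G 5 ∧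
    nChars G 1 ≤ nChars G 6 ∧
    nChars (↥C ⧸ (L ⊓ C).subgroupOf C) 2 ≤ nChars G 8 := by
  obtain ⟨e⟩ := hL
  let ι : S5 →* G := L.subtype.comp e.symm.toMonoidHom
  have hιL : ∀ s, ι s ∈ L := fun s => (e.symm s).2
  have hιinj : ∀ s t, ι s = ι t → s = t := fun s t h =>
    e.symm.injective (Subtype.ext h)
  have hιsurj : ∀ l ∈ L, ∃ s, ι s = l := fun l hl => ⟨e ⟨l, hl⟩, by
    change ((e.symm (e ⟨l, hl⟩) : L) : G) = l
    rw [e.symm_apply_apply]⟩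
  have hmem : ∀ x, x ∈ L ⊓ C ↔ x = 1 ∨ x = ι (rp 1) := by
    intro x
    rw [hZ]
    constructor
    · rintro ⟨y, hy, rfl⟩
      have hy' := Subgroup.mem_center_iff.1 hy
      have := centerS (e y) (fun h => by
        have := congrArg e (hy' (e.symm h))
        simpa using this)
      rcases this with h | h
      · left
        have : y = 1 := by simpa using h
        simp [this]
      · right
        rw [← h]
        change (y : G) = ((e.symm (e y) : L) : G)
        rw [e.symm_apply_apply]
    · rintro (rfl | rfl)
      · exact one_mem _
      · refine ⟨e.symm (rp 1), Subgroup.mem_center_iff.2 fun g => ?_, rfl⟩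
        apply e.injective
        simpa using central1 (e g)
  have hzC : ι (rp 1) ∈ C := ((hmem _).2 (Or.inr rfl)).2
  let z : C := ⟨ι (rp 1), hzC⟩
  have hzz : z * z = 1 := Subtype.ext (by
    change ι (rp 1) * ι (rp 1) = 1
    rw [← map_mul, rp11, map_one])
  have hzc : z ∈ Subgroup.center C := Subgroup.mem_center_iff.2 fun g => Subtype.ext
    (hcomm _ (hιL _) _ g.2).symm
  let m : S5 × C →* G := MonoidHom.noncommCoprod ι C.subtype (fun s c => hcomm _ (hιL s) _ c.2)
  have hm : ∀ s c, m (s, c) = ι s * (c : G) := fun s c => rfl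
  have hmsurj : Function.Surjective m := by
    rw [← MonoidHom.range_eq_top, eq_top_iff, ← hgen, sup_le_iff]
    constructor
    · intro l hl
      obtain ⟨s, rfl⟩ := hιsurj l hl
      exact ⟨(s, 1), by rw [hm]; simp⟩
    · intro c hc
      exact ⟨(1, ⟨c, hc⟩), by rw [hm]; simp⟩
  have hw : (rp 1, z) ∈ Subgroup.center (S5 × C) := Subgroup.mem_center_iff.2 fun g =>
    Prod.ext (central1 g.1) (Subgroup.mem_center_iff.1 hzc g.2)
  have hmk : ∀ x, m x = 1 ↔ x = 1 ∨ x = (rp 1, z) := by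
    rintro ⟨s, c⟩
    constructor
    · intro h
      rw [hm] at h
      have hs : ι s = (c : G)⁻¹ := eq_inv_of_mul_eq_one_left h
      have hc : (c : G) = (ι s)⁻¹ := eq_inv_of_mul_eq_one_right h
      have : ι s ∈ L ⊓ C := ⟨hιL s, by rw [hs]; exact C.inv_mem c.2⟩
      rcases (hmem _).1 this with h1 | h1
      · left
        refine Prod.ext (hιinj s 1 (by rw [h1, map_one])) (Subtype.ext ?_)
        change (c : G) = 1
        rw [hc, h1, inv_one]
      · right
        refine Prod.ext (hιinj _ _ h1) (Subtype.ext ?_)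
        change (c : G) = ι (rp 1)
        rw [hc, h1, ← map_inv, inv_eq_of_mul_eq_one_right rp11]
    · rintro (h | h)
      · rw [h, map_one]
      · rw [h, hm]
        exact congrArg Subtype.val hzz
  have hnorm : ((L ⊓ C).subgroupOf C).Normal :=
    ⟨by
      intro n hn g
      rw [Subgroup.mem_subgroupOf] at hn ⊢
      have h2 : (g : G) * (n : G) * (g : G)⁻¹ = (n : G) := by
        rw [← hcomm (n : G) hn.1 (g : G) g.2, mul_assoc, mul_inv_cancel, mul_one]
      simpa [h2] using hn⟩
  have hK : nChars (↥C ⧸ (L ⊓ C).subgroupOf C) 2 = (Kp z 2 2).ncard := by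
    rw [quot_set (QuotientGroup.mk' ((L ⊓ C).subgroupOf C)) (QuotientGroup.mk'_surjective _) z hzc
      (fun x => ?_) 2]
    · simp [Kp]
    · rw [← MonoidHom.mem_ker, QuotientGroup.ker_mk', Subgroup.mem_subgroupOf, hmem]
      simp only [Subtype.ext_iff]
      rfl
  have hN : ∀ d, nChars G d = (Np z d).ncard := fun d => quot_set m hmsurj (rp 1, z) hw hmk d
  rw [hK, hN, hN, hN, hN, hN, hN, hN]
  have h2 : χ 1 = 2 := by simpa using hχ.isCh.one
  refine core z (fun x => χ (m x)) ⟨(irr_comp_iff m hmsurj χ 2 hχ.isCh).1 hχ, ?_⟩ ?_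
  · change χ (m (rp 1, z)) = _
    rw [(hmk _).2 (Or.inr rfl), h2]; simp
  · change χ (m (rp 1, 1)) ≠ 2
    obtain ⟨y, hy, hy1⟩ := hker
    rcases (hmem y).1 hy with rfl | rfl
    · exact absurd rfl hy1
    · rw [hm, OneMemClass.coe_one, mul_one, ← h2]
      exact hy1
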